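/- Let G = (V,D,B) be an acyclic mixed graph with mixed components G_1, …, G_k. If for each j = 1, …, k the component G_j is generically h_j-to-one with h_j < ∞ (the fiber of φ_{G_j} has exactly h_j elements outside a proper algebraic subset of Θ_{G_j}), then G is generically h-to-one with h = ∏_{j=1}^k h_j. -/

import Mathlib

open scoped Classical Matrix

/-- The directed part of the graph contains no directed cycle. -/
def Acyclic {n : ℕ} (D : Finset (Fin n × Fin n)) : Prop :=
  ∀ v : Fin n, ¬ Relation.TransGen (fun a b => (a, b) ∈ D) v v

/-- Mixed graph axioms: the bidirected edge set is symmetric and there are no self loops. -/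
def IsMixedGraph {n : ℕ} (D B : Finset (Fin n × Fin n)) : Prop :=
  (∀ v w : Fin n, (v, w) ∈ B → (w, v) ∈ B) ∧ ∀ v : Fin n, (v, v) ∉ D ∧ (v, v) ∉ B

/-- `IsTrek D B v w L R`: `L` is the left side of a trek from `v` to `w`, listed from the top
node down to the source `v` (consecutive vertices joined by directed edges pointing towards
`v`); `R` is the right side, listed from the top down to the target `w`.  Either the two tops
coincide (no bidirected edge) or they are joined by a bidirected edge. -/
def IsTrek {n : ℕ} (D B : Finset (Fin n × Fin n)) (v w : Fin n)
    (L R : List (Fin n)) : Prop :=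
  L ≠ [] ∧ R ≠ [] ∧
    L.Chain' (fun a b => (a, b) ∈ D) ∧ R.Chain' (fun a b => (a, b) ∈ D) ∧
    L.getLast? = some v ∧ R.getLast? = some w ∧
    (L.head? = R.head? ∨
      ∃ u z : Fin n, L.head? = some u ∧ R.head? = some z ∧ (u, z) ∈ B)

/-- Product of the matrix entries `Λ x y` over the consecutive pairs `(x, y)` of a list,
i.e. the product of the directed-edge coefficients along a directed path. -/
noncomputable def edgeProd {n : ℕ} (Λ : Matrix (Fin n) (Fin n) ℝ) :
    List (Fin n) → ℝ
  | [] => 1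
  | [_] => 1
  | x :: y :: rest => Λ x y * edgeProd Λ (y :: rest)

/-- The trek monomial of the trek with sides `L`, `R`. -/
noncomputable def trekWeight {n : ℕ} (Λ Ω : Matrix (Fin n) (Fin n) ℝ)
    (L R : List (Fin n)) : ℝ :=
  (match L.head?, R.head? with
    | some u, some z => Ω u z
    | _, _ => 0) * edgeProd Λ L * edgeProd Λ R

/-- `u` is an ancestor of `v`: there is a (possibly empty) directed path from `u` to `v`. -/
def IsAncestor {n : ℕ} (D : Finset (Fin n × Fin n)) (u v : Fin n) : Prop :=
  Relation.ReflTransGen (fun a b => (a, b) ∈ D) u v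

/-- `V'` is an ancestral subset: it contains all ancestors of its members. -/
def Ancestral {n : ℕ} (D : Finset (Fin n × Fin n)) (V' : Finset (Fin n)) : Prop :=
  ∀ u v : Fin n, IsAncestor D u v → v ∈ V' → u ∈ V'

/-- The parents of `v`. -/
def paF {n : ℕ} (D : Finset (Fin n × Fin n)) (v : Fin n) : Finset (Fin n) :=
  Finset.univ.filter fun w => (w, v) ∈ D

/-- `htr D B v`: the set of vertices `w ∉ {v} ∪ sib(v)` reachable from `v` by a half-trek. -/
def htr {n : ℕ} (D B : Finset (Fin n × Fin n)) (v : Fin n) : Set (Fin n) :=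
  {w | w ≠ v ∧ (v, w) ∉ B ∧ ∃ R, IsTrek D B v w [v] R}

/-- `Y` satisfies the half-trek criterion with respect to `v`: `|Y| = |pa(v)|`,
`Y ∩ ({v} ∪ sib(v)) = ∅`, and there is a system of half-treks with no sided intersection
from `Y` to `pa(v)` (given by a source `src p ∈ Y` and a right side `R p` for each parent
`p`, with pairwise distinct sources and pairwise disjoint right sides). -/
def SatisfiesHTC {n : ℕ} (D B : Finset (Fin n × Fin n)) (v : Fin n)
    (Y : Finset (Fin n)) : Prop :=
  Y.card = (paF D v).card ∧
    (∀ y ∈ Y, y ≠ v ∧ (y, v) ∉ B) ∧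
    ∃ (src : Fin n → Fin n) (R : Fin n → List (Fin n)),
      (∀ p ∈ paF D v, src p ∈ Y ∧ IsTrek D B (src p) p [src p] (R p)) ∧
      ∀ p ∈ paF D v, ∀ q ∈ paF D v, p ≠ q →
        src p ≠ src q ∧ ∀ x ∈ R p, x ∉ R q

/-- The parameter space `Θ = ℝ^D × PD(B)`. -/
def Theta {α : Type} [Fintype α] (D B : Set (α × α)) :
    Set (Matrix α α ℝ × Matrix α α ℝ) :=
  {p : Matrix α α ℝ × Matrix α α ℝ |
    (∀ v w : α, p.1 v w ≠ 0 → (v, w) ∈ D) ∧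
      p.2.PosDef ∧ ∀ v w : α, v ≠ w → p.2 v w ≠ 0 → (v, w) ∈ B}

/-- The parameterization map `φ(Λ, Ω) = (I - Λ)⁻ᵀ Ω (I - Λ)⁻¹`. -/
noncomputable def phi {α : Type} [Fintype α] [DecidableEq α]
    (p : Matrix α α ℝ × Matrix α α ℝ) : Matrix α α ℝ :=
  ((1 - p.1)⁻¹)ᵀ * p.2 * (1 - p.1)⁻¹

/-- Evaluation of a polynomial in the entries of the two parameter matrices. -/
noncomputable def polyEval {α : Type} [Fintype α]
    (f : MvPolynomial ((α × α) ⊕ (α × α)) ℝ)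
    (p : Matrix α α ℝ × Matrix α α ℝ) : ℝ :=
  MvPolynomial.eval (Sum.elim (fun e => p.1 e.1 e.2) (fun e => p.2 e.1 e.2)) f

/-- `A` is a proper algebraic subset of `Θ`: the intersection of `Θ` with the zero set of a
polynomial in the matrix entries that does not vanish identically on `Θ`. -/
def IsProperAlg {α : Type} [Fintype α]
    (Θ A : Set (Matrix α α ℝ × Matrix α α ℝ)) : Prop :=
  ∃ f : MvPolynomial ((α × α) ⊕ (α × α)) ℝ,
    (∃ p ∈ Θ, polyEval f p ≠ 0) ∧ A = {p ∈ Θ | polyEval f p = 0}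

/-- Generic identifiability: `φ` is injective off a proper algebraic subset. -/
def GenId {α : Type} [Fintype α] [DecidableEq α] (D B : Set (α × α)) : Prop :=
  ∃ A, IsProperAlg (Theta D B) A ∧
    ∀ p ∈ Theta D B \ A, ∀ q ∈ Theta D B \ A, phi p = phi q → p = q

/-- Generic identifiability of the single coefficient `λ_{uv}`. -/
def GenIdLambda {α : Type} [Fintype α] [DecidableEq α] (D B : Set (α × α))
    (u v : α) : Prop :=
  ∃ A, IsProperAlg (Theta D B) A ∧
    ∀ p ∈ Theta D B \ A, ∀ q ∈ Theta D B \ A, phi p = phi q → p.1 u v = q.1 u v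

/-- Generic identifiability of the single coefficient `ω_{uv}`. -/
def GenIdOmega {α : Type} [Fintype α] [DecidableEq α] (D B : Set (α × α))
    (u v : α) : Prop :=
  ∃ A, IsProperAlg (Theta D B) A ∧
    ∀ p ∈ Theta D B \ A, ∀ q ∈ Theta D B \ A, phi p = phi q → p.2 u v = q.2 u v

/-- Generic identifiability of the coefficient vector `Λ_{pa(v), v}`. -/
def GenIdCol {α : Type} [Fintype α] [DecidableEq α] (D B : Set (α × α))
    (v : α) : Prop :=
  ∃ A, IsProperAlg (Theta D B) A ∧
    ∀ p ∈ Theta D B \ A, ∀ q ∈ Theta D B \ A, phi p = phi q →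
      ∀ u : α, (u, v) ∈ D → p.1 u v = q.1 u v

/-- The fiber of the parameter point `p` within `Θ`. -/
def fiber {α : Type} [Fintype α] [DecidableEq α] (D B : Set (α × α))
    (p : Matrix α α ℝ × Matrix α α ℝ) :
    Set (Matrix α α ℝ × Matrix α α ℝ) :=
  {q ∈ Theta D B | phi q = phi p}

/-- Generically infinite-to-one. -/
def GenInfToOne {α : Type} [Fintype α] [DecidableEq α] (D B : Set (α × α)) : Prop :=
  ∃ A, IsProperAlg (Theta D B) A ∧
    ∀ p ∈ Theta D B \ A, (fiber D B p).Infinite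

/-- Generically `h`-to-one: every fiber off a proper algebraic subset has exactly `h` points. -/
def GenHToOne {α : Type} [Fintype α] [DecidableEq α] (D B : Set (α × α))
    (h : ℕ) : Prop :=
  ∃ A, IsProperAlg (Theta D B) A ∧
    ∀ p ∈ Theta D B \ A, (fiber D B p).Finite ∧ (fiber D B p).ncard = h

/-- `w` lies in the connected component of `c` in the bidirected part `(V, B)`. -/
def bidirConn {n : ℕ} (B : Finset (Fin n × Fin n)) (c w : Fin n) : Prop :=
  Relation.ReflTransGen (fun a b => (a, b) ∈ B) c w

/-- The connected component `C` of `c` in the bidirected part. -/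
noncomputable def Cset {n : ℕ} (B : Finset (Fin n × Fin n)) (c : Fin n) :
    Finset (Fin n) :=
  Finset.univ.filter (bidirConn B c)

/-- The vertex set `V_i = C_i ∪ pa(C_i)` of the mixed component of `c`. -/
noncomputable def Vset {n : ℕ} (D B : Finset (Fin n × Fin n)) (c : Fin n) :
    Finset (Fin n) :=
  Cset B c ∪ Finset.univ.filter fun v => ∃ w ∈ Cset B c, (v, w) ∈ D

/-- The directed edges `D_i = {(v, w) ∈ D : v ∈ V_i, w ∈ C_i}` of the mixed component of `c`. -/
def compD {n : ℕ} (D B : Finset (Fin n × Fin n)) (c : Fin n) :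
    Set (↥(Vset D B c) × ↥(Vset D B c)) :=
  {e | ((e.1 : Fin n), (e.2 : Fin n)) ∈ D ∧ (e.2 : Fin n) ∈ Cset B c}

/-- The bidirected edges `B_i = {(v, w) ∈ B : v, w ∈ C_i}` of the mixed component of `c`. -/
def compB {n : ℕ} (D B : Finset (Fin n × Fin n)) (c : Fin n) :
    Set (↥(Vset D B c) × ↥(Vset D B c)) :=
  {e | ((e.1 : Fin n), (e.2 : Fin n)) ∈ B ∧ (e.1 : Fin n) ∈ Cset B c ∧
    (e.2 : Fin n) ∈ Cset B c}

/-- The edges of the induced subgraph `G_{V'}`, as pairs of vertices of the subtype `V'`. -/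
def inducedE {n : ℕ} (E : Finset (Fin n × Fin n)) (V' : Finset (Fin n)) :
    Set (↥V' × ↥V') :=
  {e | ((e.1 : Fin n), (e.2 : Fin n)) ∈ E}


section GeneralLemmas

set_option linter.unusedSectionVars false

variable {α : Type} [Fintype α] [DecidableEq α]

/-- unit triangularity with respect to a rank function -/
def UTri (ρ : α → ℕ) (T : Matrix α α ℝ) : Prop :=
  ∀ i j, ¬ ρ i < ρ j → T i j = (1 : Matrix α α ℝ) i j

lemma UTri.mul {ρ : α → ℕ} {S T : Matrix α α ℝ} (hS : UTri ρ S) (hT : UTri ρ T) :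
    UTri ρ (S * T) := by
  intro i j hij
  have : (1 : Matrix α α ℝ) i j = ((1 : Matrix α α ℝ) * (1 : Matrix α α ℝ) : Matrix α α ℝ) i j := by rw [one_mul]
  rw [this, Matrix.mul_apply, Matrix.mul_apply]
  refine Finset.sum_congr rfl fun k _ => ?_
  by_cases hik : ρ i < ρ k
  · have hkj : ¬ ρ k < ρ j := by omega
    have hne : k ≠ j := by rintro rfl; exact hij hik
    rw [hT k j hkj, Matrix.one_apply_ne hne]; simp
  · rw [hS i k hik]
    by_cases hk : i = k
    · subst hk; rw [hT i j hij]
    · rw [Matrix.one_apply_ne hk]; simp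

lemma UTri.left_inv {ρ : α → ℕ} {A X : Matrix α α ℝ} (hA : UTri ρ A) (h : X * A = 1) :
    UTri ρ X := by
  have key : ∀ m : ℕ, ∀ i j, ρ j = m → ¬ ρ i < ρ j → X i j = (1 : Matrix α α ℝ) i j := by
    intro m
    induction m using Nat.strong_induction_on with
    | _ m ih =>
      intro i j hj hij
      rw [← h, Matrix.mul_apply, Finset.sum_eq_single j]
      · rw [hA j j (lt_irrefl _)]; simp
      · intro k _ hkj
        by_cases hk : ρ k < ρ j
        · have hne : i ≠ k := by rintro rfl; exact hij hk
          rw [ih (ρ k) (by omega) i k rfl (by omega), Matrix.one_apply_ne hne, zero_mul]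
        · rw [hA k j hk, Matrix.one_apply_ne hkj, mul_zero]
      · simp
  intro i j
  exact key _ i j rfl

lemma UTri.isUnit {ρ : α → ℕ} {A : Matrix α α ℝ} (hA : UTri ρ A) : IsUnit A := by
  rw [← Matrix.vecMul_injective_iff_isUnit]
  refine (injective_iff_map_eq_zero (Matrix.vecMulLinear A)).2 ?_
  intro x hx
  have key : ∀ m : ℕ, ∀ j, ρ j = m → x j = 0 := by
    intro m
    induction m using Nat.strong_induction_on with
    | _ m ih =>
      intro j hj
      have h1 := congrFun hx j
      simp only [Matrix.coe_vecMulLinear, Matrix.vecMul, dotProduct, Pi.zero_apply] at h1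
      rw [Finset.sum_eq_single j] at h1
      · rw [hA j j (lt_irrefl _)] at h1; simpa using h1
      · intro k _ hkj
        by_cases hk : ρ k < ρ j
        · rw [ih (ρ k) (by omega) k rfl, zero_mul]
        · rw [hA k j hk, Matrix.one_apply_ne hkj, mul_zero]
      · simp
  funext j
  exact key _ j rfl

lemma posDef_eq_zero {P : Matrix α α ℝ} (hP : P.PosDef) {x : α → ℝ}
    (hx : ∑ a, ∑ b, x a * P a b * x b = 0) : x = 0 := by
  by_contra hne
  have h1 := hP.dotProduct_mulVec_pos hne
  simp only [dotProduct, Matrix.mulVec, Finset.mul_sum, star_trivial] at h1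
  simp only [← mul_assoc] at h1
  linarith

/-- uniqueness of Cholesky factors -/
lemma UTri.eq_one {ρ : α → ℕ} {N P : Matrix α α ℝ} (hN : UTri ρ N) (hP : P.PosDef)
    (h : Nᵀ * P * N = P) : N = 1 := by
  have key : ∀ m : ℕ, ∀ j, ρ j = m → ∀ i, N i j = (1 : Matrix α α ℝ) i j := by
    intro m
    induction m using Nat.strong_induction_on with
    | _ m ih =>
      intro j hj
      -- orthogonality
      have h1 : ∀ k, ρ k < ρ j → ∑ b, P k b * (N b j - (1 : Matrix α α ℝ) b j) = 0 := by
        intro k hk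
        have h2 := congrFun (congrFun h k) j
        rw [Matrix.mul_assoc, Matrix.mul_apply] at h2
        have h3 : ∀ a, Nᵀ k a = (1 : Matrix α α ℝ) a k := fun a =>
          ih (ρ k) (by omega) k rfl a
        simp only [h3, Matrix.one_apply, ite_mul, one_mul, zero_mul, Finset.sum_ite_eq',
          Finset.mem_univ, if_true] at h2
        simp only [mul_sub, Finset.sum_sub_distrib]
        rw [Matrix.mul_apply] at h2
        rw [h2]
        simp [Matrix.one_apply]
      have h4 : (fun a => N a j - (1 : Matrix α α ℝ) a j) = 0 := by
        apply posDef_eq_zero hP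
        refine Finset.sum_eq_zero fun a _ => ?_
        by_cases ha : ρ a < ρ j
        · simp only [mul_assoc]
          rw [← Finset.mul_sum, h1 a ha, mul_zero]
        · rw [hN a j ha]; simp
      intro i
      have := congrFun h4 i
      simp only [Pi.zero_apply] at this
      linarith
  ext i j
  exact key _ j rfl i

lemma phi_eq_iff {ρ : α → ℕ} {p q : Matrix α α ℝ × Matrix α α ℝ}
    (hp : UTri ρ (1 - p.1)) (hq : UTri ρ (1 - q.1)) :
    phi q = phi p ↔ ∃ L, (1 - p.1) * L = 1 - q.1 ∧ q.2 = Lᵀ * p.2 * L := by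
  have up := (Matrix.isUnit_iff_isUnit_det _).1 hp.isUnit
  have uq := (Matrix.isUnit_iff_isUnit_det _).1 hq.isUnit
  unfold phi
  set A := 1 - p.1
  set A' := 1 - q.1
  have e1 : A⁻¹ * A = 1 := Matrix.nonsing_inv_mul _ up
  have e2 : A * A⁻¹ = 1 := Matrix.mul_nonsing_inv _ up
  have e3 : A'⁻¹ * A' = 1 := Matrix.nonsing_inv_mul _ uq
  have e4 : A' * A'⁻¹ = 1 := Matrix.mul_nonsing_inv _ uq
  have e5 : A'ᵀ * A'⁻¹ᵀ = 1 := by rw [← Matrix.transpose_mul, e3, Matrix.transpose_one]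
  constructor
  · intro h
    refine ⟨A⁻¹ * A', by rw [← Matrix.mul_assoc, e2, Matrix.one_mul], ?_⟩
    calc q.2 = (A'ᵀ * A'⁻¹ᵀ) * q.2 * (A'⁻¹ * A') := by rw [e5, e3]; simp
      _ = A'ᵀ * (A'⁻¹ᵀ * q.2 * A'⁻¹) * A' := by simp only [Matrix.mul_assoc]
      _ = _ := by rw [h, Matrix.transpose_mul]; simp only [Matrix.mul_assoc]
  · rintro ⟨L, h1, h2⟩
    have h3 : L * A'⁻¹ = A⁻¹ := by
      calc L * A'⁻¹ = (A⁻¹ * A) * L * A'⁻¹ := by rw [e1, Matrix.one_mul]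
        _ = A⁻¹ * (A * L) * A'⁻¹ := by simp only [Matrix.mul_assoc]
        _ = A⁻¹ := by rw [h1, Matrix.mul_assoc, e4, Matrix.mul_one]
    rw [h2, ← h3, Matrix.transpose_mul]
    simp only [Matrix.mul_assoc]

/-- Block support with respect to the partition `C`, complement of `C`. -/
def Resp (C : Finset α) (M : Matrix α α ℝ) : Prop :=
  ∀ a b, (a ∈ C ∧ b ∉ C ∨ a ∉ C ∧ b ∈ C) → M a b = 0

lemma key_block {ρ : α → ℕ} {p q : Matrix α α ℝ × Matrix α α ℝ}
    (hp : UTri ρ (1 - p.1)) (hq : UTri ρ (1 - q.1)) (hpd : p.2.PosDef) (C : Finset α)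
    (hpC : Resp C p.2) (hqC : Resp C q.2) (h : phi q = phi p) :
    ∃ L, (1 - p.1) * L = 1 - q.1 ∧ q.2 = Lᵀ * p.2 * L ∧ Resp C L := by
  obtain ⟨L, h1, h2⟩ := (phi_eq_iff hp hq).1 h
  refine ⟨L, h1, h2, ?_⟩
  have up := (Matrix.isUnit_iff_isUnit_det _).1 hp.isUnit
  have uq := (Matrix.isUnit_iff_isUnit_det _).1 hq.isUnit
  set A := 1 - p.1
  set A' := 1 - q.1
  have e1 : A⁻¹ * A = 1 := Matrix.nonsing_inv_mul _ up
  have e2 : A * A⁻¹ = 1 := Matrix.mul_nonsing_inv _ up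
  have e3 : A'⁻¹ * A' = 1 := Matrix.nonsing_inv_mul _ uq
  have e4 : A' * A'⁻¹ = 1 := Matrix.mul_nonsing_inv _ uq
  have tL : UTri ρ L := by
    have : L = A⁻¹ * A' := by rw [← h1, ← Matrix.mul_assoc, e1, Matrix.one_mul]
    rw [this]
    exact (hp.left_inv e1).mul hq
  have tL2 : UTri ρ (A'⁻¹ * A) := (hq.left_inv e3).mul hp
  have eL2 : (A'⁻¹ * A) * L = 1 := by rw [Matrix.mul_assoc, h1, e3]
  have eL : L * (A'⁻¹ * A) = 1 := mul_eq_one_comm.1 eL2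
  generalize A'⁻¹ * A = L2 at tL2 eL2 eL
  let s : α → ℝ := fun a => if a ∈ C then 1 else -1
  have hs : ∀ a, s a * s a = 1 := by intro a; simp only [s]; split_ifs <;> norm_num
  let S : Matrix α α ℝ := Matrix.diagonal s
  have hSS : S * S = 1 := by
    simp only [S, Matrix.diagonal_mul_diagonal, hs, Matrix.diagonal_one]
  have hSt : Sᵀ = S := Matrix.diagonal_transpose _
  have hconj : ∀ M, Resp C M → S * M * S = M := by
    intro M hM
    ext a b
    simp only [S, Matrix.mul_diagonal, Matrix.diagonal_mul]
    by_cases ha : a ∈ C <;> by_cases hb : b ∈ C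
    · simp [s, ha, hb]
    · simp [hM a b (Or.inl ⟨ha, hb⟩)]
    · simp [hM a b (Or.inr ⟨ha, hb⟩)]
    · simp [s, ha, hb]
  have tSLS : UTri ρ (S * L * S) := by
    intro i j hij
    simp only [S, Matrix.mul_diagonal, Matrix.diagonal_mul]
    rw [tL i j hij]
    by_cases hh : i = j
    · subst hh; simp [hs]
    · simp [Matrix.one_apply_ne hh]
  have hN : S * L * S * L2 = 1 := by
    refine (tSLS.mul tL2).eq_one hpd ?_
    have h3 : (S * L * S)ᵀ * p.2 * (S * L * S) = q.2 := by
      rw [Matrix.transpose_mul, Matrix.transpose_mul, hSt]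
      calc S * (Lᵀ * S) * p.2 * (S * L * S) = S * (Lᵀ * (S * p.2 * S) * L) * S := by
            simp only [Matrix.mul_assoc]
        _ = q.2 := by rw [hconj _ hpC, ← h2, hconj _ hqC]
    rw [Matrix.transpose_mul]
    calc L2ᵀ * (S * L * S)ᵀ * p.2 * (S * L * S * L2)
        = L2ᵀ * ((S * L * S)ᵀ * p.2 * (S * L * S)) * L2 := by simp only [Matrix.mul_assoc]
      _ = (L * L2)ᵀ * p.2 * (L * L2) := by
          rw [h3, h2, Matrix.transpose_mul]; simp only [Matrix.mul_assoc]
      _ = p.2 := by rw [eL]; simp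
  have h5 : S * L * S = L := by
    calc S * L * S = S * L * S * (L2 * L) := by rw [eL2, Matrix.mul_one]
      _ = (S * L * S * L2) * L := by simp only [Matrix.mul_assoc]
      _ = L := by rw [hN, Matrix.one_mul]
  intro a b hab
  have h6 := congrFun (congrFun h5 a) b
  simp only [S, Matrix.mul_diagonal, Matrix.diagonal_mul] at h6
  rcases hab with ⟨ha, hb⟩ | ⟨ha, hb⟩ <;> simp [s, ha, hb] at h6 <;> linarith

/-- Block relation between two parameters. -/
def BR (C : Finset α) (p q : Matrix α α ℝ × Matrix α α ℝ) : Prop :=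
  ∃ L : Matrix α α ℝ,
    (∀ i, ∀ c ∈ C, ∑ k ∈ C, (1 - p.1) i k * L k c = (1 - q.1) i c) ∧
    ∀ c ∈ C, ∀ d ∈ C, q.2 c d = ∑ k ∈ C, ∑ l ∈ C, L k c * p.2 k l * L l d

lemma triple_apply (L P : Matrix α α ℝ) (c d : α) :
    (Lᵀ * P * L) c d = ∑ k, ∑ l, L k c * P k l * L l d := by
  rw [Matrix.mul_assoc, Matrix.mul_apply]
  refine Finset.sum_congr rfl fun k _ => ?_
  rw [Matrix.mul_apply, Finset.mul_sum]
  refine Finset.sum_congr rfl fun l _ => ?_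
  rw [Matrix.transpose_apply, mul_assoc]

lemma BR_of_phi {ρ : α → ℕ} {p q : Matrix α α ℝ × Matrix α α ℝ}
    (hp : UTri ρ (1 - p.1)) (hq : UTri ρ (1 - q.1)) (hpd : p.2.PosDef) (C : Finset α)
    (hpC : Resp C p.2) (hqC : Resp C q.2) (h : phi q = phi p) : BR C p q := by
  obtain ⟨L, h1, h2, h3⟩ := key_block hp hq hpd C hpC hqC h
  refine ⟨L, ?_, ?_⟩
  · intro i c hc
    rw [← h1, Matrix.mul_apply]
    refine Finset.sum_subset (Finset.subset_univ _) fun k _ hk => ?_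
    rw [h3 k c (Or.inr ⟨hk, hc⟩), mul_zero]
  · intro c hc d hd
    rw [h2, triple_apply]
    symm
    refine (Finset.sum_congr rfl fun k _ => ?_).trans
      (Finset.sum_subset (Finset.subset_univ C) fun k _ hk => ?_)
    · refine Finset.sum_subset (Finset.subset_univ _) fun l _ hl => ?_
      rw [h3 l d (Or.inr ⟨hl, hd⟩), mul_zero]
    · refine Finset.sum_eq_zero fun l _ => ?_
      rw [h3 k c (Or.inr ⟨hk, hc⟩), zero_mul, zero_mul]

lemma phi_of_BR {ι : Type} [DecidableEq ι] {ρ : α → ℕ} {p q : Matrix α α ℝ × Matrix α α ℝ}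
    (hp : UTri ρ (1 - p.1)) (hq : UTri ρ (1 - q.1)) (β : α → ι)
    (hpC : ∀ a b, β a ≠ β b → p.2 a b = 0) (hqC : ∀ a b, β a ≠ β b → q.2 a b = 0)
    (h : ∀ r, BR (Finset.univ.filter fun a => β a = r) p q) : phi q = phi p := by
  choose L h1 h2 using h
  rw [phi_eq_iff hp hq]
  refine ⟨Matrix.of fun a b => if β a = β b then L (β b) a b else 0, ?_, ?_⟩
  · ext i c
    rw [← h1 (β c) i c (by simp), Matrix.mul_apply, Finset.sum_filter]
    refine Finset.sum_congr rfl fun k _ => ?_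
    rw [Matrix.of_apply]
    split_ifs <;> simp
  · ext c d
    rw [triple_apply]
    simp only [Matrix.of_apply]
    by_cases hcd : β c = β d
    · rw [h2 (β d) c (by simp [hcd]) d (by simp), Finset.sum_filter]
      refine Finset.sum_congr rfl fun k _ => ?_
      rw [Finset.sum_filter]
      split_ifs with hk hk' hk'
      · refine Finset.sum_congr rfl fun l _ => ?_
        split_ifs <;> simp [hcd]
      · exact absurd (hk.trans hcd.symm) hk'
      · exact absurd (hk'.trans hcd) hk
      · simp
    · rw [hqC c d hcd]
      symm
      refine Finset.sum_eq_zero fun k _ => Finset.sum_eq_zero fun l _ => ?_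
      split_ifs with hk hl
      · rw [hpC k l (by rw [hk, hl]; exact hcd)]; simp
      all_goals simp

lemma posDef_block {ι : Type} [Fintype ι] [DecidableEq ι] (β : α → ι) (Z : Matrix α α ℝ)
    (hZ : ∀ a b, β a ≠ β b → Z a b = 0)
    (hpd : ∀ r, (Z.submatrix (Subtype.val : {a // β a = r} → α) Subtype.val).PosDef) :
    Z.PosDef := by
  refine Matrix.PosDef.of_dotProduct_mulVec_pos ?_ ?_
  · ext a b
    rw [Matrix.conjTranspose_apply, star_trivial]
    by_cases hab : β a = β b
    · have := congrFun (congrFun (hpd (β b)).isHermitian ⟨a, hab⟩) ⟨b, rfl⟩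
      simpa using this
    · rw [hZ a b hab, hZ b a (Ne.symm hab)]
  · intro x hx
    have e : star x ⬝ᵥ (Z *ᵥ x) = ∑ r, (star fun a : {a // β a = r} => x a) ⬝ᵥ
        ((Z.submatrix (Subtype.val : {a // β a = r} → α) Subtype.val) *ᵥ
          fun a : {a // β a = r} => x a) := by
      simp only [dotProduct, Matrix.mulVec, star_trivial, Pi.star_apply, Matrix.submatrix_apply]
      rw [← Finset.sum_fiberwise Finset.univ β]
      refine Finset.sum_congr rfl fun r _ => ?_
      rw [Finset.sum_subtype (p := fun a => β a = r) _ (by simp)]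
      refine Finset.sum_congr rfl fun a _ => ?_
      congr 1
      rw [← Finset.sum_subtype (p := fun a => β a = r) (Finset.univ.filter fun a => β a = r)
        (by simp) (fun b => Z a b * x b), Finset.sum_filter]
      refine Finset.sum_congr rfl fun b _ => ?_
      split_ifs with hb
      · rfl
      · rw [hZ a b (by rw [a.2]; exact Ne.symm hb), zero_mul]
    rw [e]
    obtain ⟨a, ha⟩ := Function.ne_iff.1 hx
    refine Finset.sum_pos' (fun r _ => (hpd r).posSemidef.dotProduct_mulVec_nonneg _)
      ⟨β a, Finset.mem_univ _, (hpd (β a)).dotProduct_mulVec_pos ?_⟩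
    intro h0
    exact ha (congrFun h0 ⟨a, rfl⟩)

end GeneralLemmas

section Components

variable {n : ℕ}

/-- extension of a matrix by zero -/
noncomputable def extM (V : Finset (Fin n)) (M : Matrix V V ℝ) : Matrix (Fin n) (Fin n) ℝ :=
  Matrix.of fun a b => if h : a ∈ V ∧ b ∈ V then M ⟨a, h.1⟩ ⟨b, h.2⟩ else 0

lemma extM_apply (V : Finset (Fin n)) (M : Matrix V V ℝ) (a b : V) :
    extM V M a b = M a b := by
  simp [extM]

/-- parameters on a component -/
abbrev CP (D B : Finset (Fin n × Fin n)) (r : Fin n) : Type :=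
  Matrix ↥(Vset D B r) ↥(Vset D B r) ℝ × Matrix ↥(Vset D B r) ↥(Vset D B r) ℝ

/-- restriction of a parameter to a component -/
noncomputable def proj (D B : Finset (Fin n × Fin n)) (r : Fin n)
    (W : Matrix ↥(Vset D B r) ↥(Vset D B r) ℝ)
    (q : Matrix (Fin n) (Fin n) ℝ × Matrix (Fin n) (Fin n) ℝ) : CP D B r :=
  (Matrix.of fun a b => if (b : Fin n) ∈ Cset B r then q.1 a b else 0,
   Matrix.of fun a b => if (a : Fin n) ∈ Cset B r ∧ (b : Fin n) ∈ Cset B r then q.2 a b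
    else W a b)

/-- assembling component parameters -/
noncomputable def asm (D B : Finset (Fin n × Fin n)) {R : Finset (Fin n)} (rep : Fin n → R)
    (y : ∀ r : R, CP D B r) : Matrix (Fin n) (Fin n) ℝ × Matrix (Fin n) (Fin n) ℝ :=
  (Matrix.of fun a b => extM _ (y (rep b)).1 a b,
   Matrix.of fun a b => if rep a = rep b then extM _ (y (rep b)).2 a b else 0)

/-- the component as a subset of the vertices of the mixed component -/
noncomputable def Csub (D B : Finset (Fin n × Fin n)) (r : Fin n) :
    Finset ↥(Vset D B r) :=
  Finset.univ.filter fun a => (a : Fin n) ∈ Cset B r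

lemma mem_Csub {D B : Finset (Fin n × Fin n)} {r : Fin n} (a : ↥(Vset D B r)) :
    a ∈ Csub D B r ↔ (a : Fin n) ∈ Cset B r := by
  simp [Csub]

lemma C_sub_V {D B : Finset (Fin n × Fin n)} {r a : Fin n} (h : a ∈ Cset B r) :
    a ∈ Vset D B r := Finset.mem_union_left _ h

lemma pa_sub_V {D B : Finset (Fin n × Fin n)} {r a c : Fin n} (h : c ∈ Cset B r)
    (hac : (a, c) ∈ D) : a ∈ Vset D B r :=
  Finset.mem_union_right _ (by simp only [Finset.mem_filter, Finset.mem_univ, true_and]; exact ⟨c, h, hac⟩)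

lemma sum_Csub {D B : Finset (Fin n × Fin n)} {r : Fin n} (f : Fin n → ℝ) :
    ∑ k ∈ Csub D B r, f k = ∑ k ∈ Cset B r, f k := by
  refine Finset.sum_bij (fun a _ => (a : Fin n)) (fun a ha => (mem_Csub a).1 ha)
    (fun a _ b _ h => Subtype.ext h) (fun b hb => ⟨⟨b, C_sub_V hb⟩, (mem_Csub _).2 hb, rfl⟩)
    (fun _ _ => rfl)

/-- rank function -/
noncomputable def rk (D : Finset (Fin n × Fin n)) (v : Fin n) : ℕ :=
  (Finset.univ.filter fun u => Relation.TransGen (fun a b => (a, b) ∈ D) u v).card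

lemma rk_lt {D : Finset (Fin n × Fin n)} (hac : Acyclic D) {a b : Fin n} (h : (a, b) ∈ D) :
    rk D a < rk D b := by
  refine Finset.card_lt_card ⟨?_, ?_⟩
  · intro u hu
    simp only [Finset.mem_filter, Finset.mem_univ, true_and] at hu ⊢
    exact hu.tail h
  · intro hs
    have : a ∈ Finset.univ.filter fun u => Relation.TransGen (fun a b => (a, b) ∈ D) u b := by
      simp only [Finset.mem_filter, Finset.mem_univ, true_and]
      exact Relation.TransGen.single h
    have := hs this
    simp only [Finset.mem_filter, Finset.mem_univ, true_and] at this
    exact hac a this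

lemma UTri_of {α : Type} [Fintype α] [DecidableEq α] {ρ : α → ℕ} {D B : Set (α × α)}
    (hD : ∀ a b, (a, b) ∈ D → ρ a < ρ b) {p} (hp : p ∈ Theta D B) : UTri ρ (1 - p.1) := by
  intro i j hij
  have : p.1 i j = 0 := by
    by_contra h
    exact hij (hD _ _ (hp.1 i j h))
  simp [this]

lemma UTri_G {D B : Finset (Fin n × Fin n)} (hac : Acyclic D) {p}
    (hp : p ∈ Theta (↑D : Set (Fin n × Fin n)) ↑B) : UTri (rk D) (1 - p.1) :=
  UTri_of (fun _ _ h => rk_lt hac h) hp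

lemma UTri_comp {D B : Finset (Fin n × Fin n)} (hac : Acyclic D) {r : Fin n} {p : CP D B r}
    (hp : p ∈ Theta (compD D B r) (compB D B r)) : UTri (fun a : ↥(Vset D B r) => rk D a) (1 - p.1) :=
  UTri_of (fun _ _ h => rk_lt hac h.1) hp

lemma Resp_comp {D B : Finset (Fin n × Fin n)} {r : Fin n} {p : CP D B r}
    (hp : p ∈ Theta (compD D B r) (compB D B r)) : Resp (Csub D B r) p.2 := by
  intro a b hab
  by_contra h
  have hne : a ≠ b := by rintro rfl; tauto
  have := hp.2.2 a b hne h
  simp only [mem_Csub] at hab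
  have h2 := this.2
  simp only at h2
  tauto

lemma Resp_compl {α : Type} [Fintype α] [DecidableEq α] {C : Finset α} {M : Matrix α α ℝ}
    (h : Resp C M) : Resp Cᶜ M := by
  intro a b hab
  apply h
  simp only [Finset.mem_compl] at hab
  tauto

lemma Resp_G {D B : Finset (Fin n × Fin n)} {R : Finset (Fin n)} {rep : Fin n → R}
    (hC : ∀ (r : R) v, v ∈ Cset B r ↔ rep v = r)
    (hB : ∀ a b, (a, b) ∈ B → rep a = rep b) {p}
    (hp : p ∈ Theta (↑D : Set (Fin n × Fin n)) ↑B) (r : R) : Resp (Cset B r) p.2 := by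
  intro a b hab
  by_contra h
  have hne : a ≠ b := by rintro rfl; tauto
  have := hB _ _ (hp.2.2 a b hne h)
  simp only [hC, this] at hab
  tauto

lemma block_G {D B : Finset (Fin n × Fin n)} {R : Finset (Fin n)} {rep : Fin n → R}
    (hB : ∀ a b, (a, b) ∈ B → rep a = rep b) {p}
    (hp : p ∈ Theta (↑D : Set (Fin n × Fin n)) ↑B) (a b : Fin n) (hab : rep a ≠ rep b) :
    p.2 a b = 0 := by
  by_contra h
  have hne : a ≠ b := by rintro rfl; tauto
  exact hab (hB _ _ (hp.2.2 a b hne h))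

lemma col_comp {D B : Finset (Fin n × Fin n)} {r : Fin n} {p : CP D B r}
    (hp : p ∈ Theta (compD D B r) (compB D B r)) (a b : ↥(Vset D B r)) (hb : b ∉ Csub D B r) :
    p.1 a b = 0 := by
  by_contra h
  exact hb ((mem_Csub _).2 (hp.1 a b h).2)

lemma proj_mem {D B : Finset (Fin n × Fin n)} {r : Fin n} {w : CP D B r}
    (hw : w ∈ Theta (compD D B r) (compB D B r)) {q}
    (hq : q ∈ Theta (↑D : Set (Fin n × Fin n)) ↑B) :
    proj D B r w.2 q ∈ Theta (compD D B r) (compB D B r) := by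
  refine ⟨?_, ?_, ?_⟩
  · intro a b h
    simp only [proj, Matrix.of_apply, ne_eq, ite_eq_right_iff, Classical.not_imp] at h
    exact ⟨hq.1 _ _ h.2, h.1⟩
  · refine posDef_block (fun a => decide (a ∈ Csub D B r)) _ ?_ ?_
    · intro a b hab
      simp only [ne_eq, decide_eq_decide] at hab
      have h1 : ¬ ((a : Fin n) ∈ Cset B r ∧ (b : Fin n) ∈ Cset B r) := by
        rw [← mem_Csub, ← mem_Csub]; tauto
      simp only [proj, Matrix.of_apply, if_neg h1]
      exact Resp_comp hw a b (by tauto)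
    · intro t
      cases t with
      | true =>
        have : ((proj D B r w.2 q).2.submatrix
            (Subtype.val : {a // decide (a ∈ Csub D B r) = true} → _)
            (Subtype.val : {a // decide (a ∈ Csub D B r) = true} → _)) =
            q.2.submatrix (fun a : {a // decide (a ∈ Csub D B r) = true} => (a.1 : Fin n))
              (fun a : {a // decide (a ∈ Csub D B r) = true} => (a.1 : Fin n)) := by
          ext a b
          have ha := a.2
          have hb := b.2
          simp only [decide_eq_true_eq, mem_Csub] at ha hb
          simp [proj, ha, hb]
        rw [this]
        exact hq.2.1.submatrix (fun a b h => Subtype.ext (Subtype.ext h))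
      | false =>
        have : ((proj D B r w.2 q).2.submatrix
            (Subtype.val : {a // decide (a ∈ Csub D B r) = false} → _)
            (Subtype.val : {a // decide (a ∈ Csub D B r) = false} → _)) =
            w.2.submatrix Subtype.val Subtype.val := by
          ext a b
          have ha := a.2
          simp only [decide_eq_false_iff_not, mem_Csub] at ha
          simp [proj, ha]
        rw [this]
        exact hw.2.1.submatrix Subtype.val_injective
  · intro a b hab h
    by_cases hc : (a : Fin n) ∈ Cset B r ∧ (b : Fin n) ∈ Cset B r
    · simp only [proj, Matrix.of_apply, if_pos hc] at h
      exact ⟨hq.2.2 _ _ (fun e => hab (Subtype.ext e)) h, hc⟩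
    · simp only [proj, Matrix.of_apply, if_neg hc] at h
      exact hw.2.2 a b hab h

lemma asm_mem {D B : Finset (Fin n × Fin n)} {R : Finset (Fin n)} {rep : Fin n → R}
    (hC : ∀ (r : R) v, v ∈ Cset B r ↔ rep v = r)
    {y : ∀ r : R, CP D B r} (hy : ∀ r : R, y r ∈ Theta (compD D B r) (compB D B r)) :
    asm D B rep y ∈ Theta (↑D : Set (Fin n × Fin n)) ↑B := by
  have hV : ∀ (r : R) v, rep v = r → v ∈ Vset D B r := fun r v h => C_sub_V ((hC r v).2 h)
  refine ⟨?_, ?_, ?_⟩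
  · intro a b h
    simp only [asm, extM, Matrix.of_apply] at h
    split_ifs at h with h1
    · exact ((hy (rep b)).1 _ _ h).1
    · exact absurd rfl h
  · refine posDef_block rep _ ?_ ?_
    · intro a b hab
      simp [asm, hab]
    · intro r
      have : ((asm D B rep y).2.submatrix (Subtype.val : {a // rep a = r} → _) Subtype.val) =
          (y r).2.submatrix (fun a : {a // rep a = r} => ⟨a.1, hV r a.1 a.2⟩)
            (fun a : {a // rep a = r} => ⟨a.1, hV r a.1 a.2⟩) := by
        ext ⟨a, ha⟩ ⟨b, hb⟩
        subst hb
        simp [asm, extM, ha, hV _ _ ha, hV _ b rfl]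
      rw [this]
      refine (hy r).2.1.submatrix (fun a b h => Subtype.ext ?_)
      simpa using h
  · intro a b hab h
    simp only [asm, extM, Matrix.of_apply] at h
    split_ifs at h with h1 h2
    · exact ((hy (rep b)).2.2 _ _ (by simpa using hab) h).1
    · exact absurd rfl h
    · exact absurd rfl h

lemma proj_asm {D B : Finset (Fin n × Fin n)} {R : Finset (Fin n)} {rep : Fin n → R}
    (hC : ∀ (r : R) v, v ∈ Cset B r ↔ rep v = r)
    {y : ∀ r : R, CP D B r} (r : R) (hy : y r ∈ Theta (compD D B r) (compB D B r))
    (W : Matrix ↥(Vset D B r) ↥(Vset D B r) ℝ)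
    (hW : ∀ a b : ↥(Vset D B r), ¬ ((a : Fin n) ∈ Cset B r ∧ (b : Fin n) ∈ Cset B r) →
      (y r).2 a b = W a b) :
    proj D B r W (asm D B rep y) = y r := by
  refine Prod.ext ?_ ?_
  · ext a b
    simp only [proj, asm, Matrix.of_apply]
    split_ifs with hb
    · rw [(hC r b).1 hb, extM_apply]
    · exact (col_comp hy a b (by rwa [mem_Csub])).symm
  · ext a b
    simp only [proj, asm, Matrix.of_apply]
    by_cases hab : (a : Fin n) ∈ Cset B r ∧ (b : Fin n) ∈ Cset B r
    · rw [if_pos hab, (hC r b).1 hab.2, (hC r a).1 hab.1, if_pos rfl, extM_apply]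
    · rw [if_neg hab, hW a b hab]

lemma proj_inj {D B : Finset (Fin n × Fin n)} {R : Finset (Fin n)} {rep : Fin n → R}
    (hC : ∀ (r : R) v, v ∈ Cset B r ↔ rep v = r)
    (hB : ∀ a b, (a, b) ∈ B → rep a = rep b)
    (W : ∀ r : R, Matrix ↥(Vset D B r) ↥(Vset D B r) ℝ) {p q}
    (hp : p ∈ Theta (↑D : Set (Fin n × Fin n)) ↑B)
    (hq : q ∈ Theta (↑D : Set (Fin n × Fin n)) ↑B)
    (h : ∀ r : R, proj D B r (W r) p = proj D B r (W r) q) : p = q := by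
  have hV : ∀ (r : R) v, rep v = r → v ∈ Vset D B r := fun r v h => C_sub_V ((hC r v).2 h)
  refine Prod.ext ?_ ?_
  · ext a b
    have hb : b ∈ Cset B (rep b) := (hC _ _).2 rfl
    by_cases ha : a ∈ Vset D B (rep b)
    · have h1 := congrFun (congrFun (congrArg Prod.fst (h (rep b))) ⟨a, ha⟩) ⟨b, C_sub_V hb⟩
      simpa [proj, hb] using h1
    · have hz : ∀ p, p ∈ Theta (↑D : Set (Fin n × Fin n)) ↑B → p.1 a b = 0 := by
        intro p hp
        by_contra h0
        exact ha (pa_sub_V hb (hp.1 _ _ h0))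
      rw [hz p hp, hz q hq]
  · ext a b
    by_cases hab : rep a = rep b
    · have hb : b ∈ Cset B (rep b) := (hC _ _).2 rfl
      have ha : a ∈ Cset B (rep b) := (hC _ _).2 hab
      have h1 := congrFun (congrFun (congrArg Prod.snd (h (rep b))) ⟨a, C_sub_V ha⟩)
        ⟨b, C_sub_V hb⟩
      simpa [proj, hb, ha] using h1
    · rw [block_G hB hp a b hab, block_G hB hq a b hab]

lemma one_sub_proj {D B : Finset (Fin n × Fin n)} {r : Fin n}
    (W : Matrix ↥(Vset D B r) ↥(Vset D B r) ℝ)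
    (q : Matrix (Fin n) (Fin n) ℝ × Matrix (Fin n) (Fin n) ℝ)
    (a b : ↥(Vset D B r)) (hb : b ∈ Csub D B r) :
    (1 - (proj D B r W q).1) a b = (1 - q.1) a b := by
  rw [mem_Csub] at hb
  simp only [Matrix.sub_apply, Matrix.one_apply, proj, Matrix.of_apply, if_pos hb,
    Subtype.ext_iff]

lemma proj_snd {D B : Finset (Fin n × Fin n)} {r : Fin n}
    (W : Matrix ↥(Vset D B r) ↥(Vset D B r) ℝ)
    (q : Matrix (Fin n) (Fin n) ℝ × Matrix (Fin n) (Fin n) ℝ)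
    (a b : ↥(Vset D B r)) (ha : a ∈ Csub D B r) (hb : b ∈ Csub D B r) :
    (proj D B r W q).2 a b = q.2 a b := by
  rw [mem_Csub] at ha hb
  simp [proj, ha, hb]

lemma BR_proj {D B : Finset (Fin n × Fin n)} {r : Fin n}
    (W : Matrix ↥(Vset D B r) ↥(Vset D B r) ℝ)
    {p q : Matrix (Fin n) (Fin n) ℝ × Matrix (Fin n) (Fin n) ℝ}
    (h : BR (Cset B r) p q) : BR (Csub D B r) (proj D B r W p) (proj D B r W q) := by
  obtain ⟨L, h1, h2⟩ := h
  refine ⟨L.submatrix Subtype.val Subtype.val, ?_, ?_⟩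
  · intro i c hc
    rw [one_sub_proj W q i c hc, ← h1 i c ((mem_Csub c).1 hc),
      ← sum_Csub (D := D) (fun k => (1 - p.1) i k * L k c)]
    refine Finset.sum_congr rfl fun k hk => ?_
    rw [one_sub_proj W p i k hk, Matrix.submatrix_apply]
  · intro c hc d hd
    rw [proj_snd W q c d hc hd, h2 c ((mem_Csub c).1 hc) d ((mem_Csub d).1 hd),
      ← sum_Csub (D := D) (fun k => ∑ l ∈ Cset B r, L k c * p.2 k l * L l d)]
    refine Finset.sum_congr rfl fun k hk => ?_
    rw [← sum_Csub (D := D) (fun l => L k c * p.2 k l * L l d)]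
    refine Finset.sum_congr rfl fun l hl => ?_
    rw [proj_snd W p k l hk hl, Matrix.submatrix_apply, Matrix.submatrix_apply]

lemma BR_of_proj {D B : Finset (Fin n × Fin n)} {r : Fin n}
    (W : Matrix ↥(Vset D B r) ↥(Vset D B r) ℝ)
    {p q : Matrix (Fin n) (Fin n) ℝ × Matrix (Fin n) (Fin n) ℝ}
    (hp : p ∈ Theta (↑D : Set (Fin n × Fin n)) ↑B)
    (hq : q ∈ Theta (↑D : Set (Fin n × Fin n)) ↑B)
    (h : BR (Csub D B r) (proj D B r W p) (proj D B r W q)) : BR (Cset B r) p q := by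
  obtain ⟨L, h1, h2⟩ := h
  refine ⟨extM _ L, ?_, ?_⟩
  · intro i c hc
    by_cases hi : i ∈ Vset D B r
    · have hc' : (⟨c, C_sub_V hc⟩ : ↥(Vset D B r)) ∈ Csub D B r := (mem_Csub _).2 hc
      have h3 := h1 ⟨i, hi⟩ ⟨c, C_sub_V hc⟩ hc'
      rw [one_sub_proj W q _ _ hc'] at h3
      rw [← h3, ← sum_Csub (D := D) (fun k => (1 - p.1) i k * extM _ L k c)]
      refine Finset.sum_congr rfl fun k hk => ?_
      rw [one_sub_proj W p _ k hk, extM_apply _ L k ⟨c, C_sub_V hc⟩]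
    · have hz : ∀ p, p ∈ Theta (↑D : Set (Fin n × Fin n)) ↑B → ∀ k ∈ Cset B r,
          (1 - p.1) i k = 0 := by
        intro p hp k hk
        have hne : i ≠ k := by rintro rfl; exact hi (C_sub_V hk)
        have h0 : p.1 i k = 0 := by
          by_contra h0
          exact hi (pa_sub_V hk (hp.1 _ _ h0))
        simp [h0, Matrix.one_apply_ne hne]
      rw [hz q hq c hc]
      refine Finset.sum_eq_zero fun k hk => ?_
      rw [hz p hp k hk, zero_mul]
  · intro c hc d hd
    have hc' : (⟨c, C_sub_V hc⟩ : ↥(Vset D B r)) ∈ Csub D B r := (mem_Csub _).2 hc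
    have hd' : (⟨d, C_sub_V hd⟩ : ↥(Vset D B r)) ∈ Csub D B r := (mem_Csub _).2 hd
    have h3 := h2 _ hc' _ hd'
    rw [proj_snd W q _ _ hc' hd'] at h3
    rw [h3, ← sum_Csub (D := D)
      (fun k => ∑ l ∈ Cset B r, extM _ L k c * p.2 k l * extM _ L l d)]
    refine Finset.sum_congr rfl fun k hk => ?_
    rw [← sum_Csub (D := D) (fun l => extM _ L k c * p.2 k l * extM _ L l d)]
    refine Finset.sum_congr rfl fun l hl => ?_
    rw [proj_snd W p k l hk hl, extM_apply _ L k ⟨c, C_sub_V hc⟩,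
      extM_apply _ L l ⟨d, C_sub_V hd⟩]

lemma outside_eq {D B : Finset (Fin n × Fin n)} (hac : Acyclic D) {r : Fin n} {y z : CP D B r}
    (hy : y ∈ Theta (compD D B r) (compB D B r)) (hz : z ∈ Theta (compD D B r) (compB D B r))
    (h : phi y = phi z) (a b : ↥(Vset D B r))
    (hab : ¬ ((a : Fin n) ∈ Cset B r ∧ (b : Fin n) ∈ Cset B r)) : y.2 a b = z.2 a b := by
  rw [← mem_Csub, ← mem_Csub] at hab
  by_cases ha : a ∈ Csub D B r
  · rw [Resp_comp hy a b (by tauto), Resp_comp hz a b (by tauto)]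
  by_cases hb : b ∈ Csub D B r
  · rw [Resp_comp hy a b (by tauto), Resp_comp hz a b (by tauto)]
  obtain ⟨L, h1, h2⟩ := BR_of_phi (UTri_comp hac hz) (UTri_comp hac hy) hz.2.1 (Csub D B r)ᶜ
    (Resp_compl (Resp_comp hz)) (Resp_compl (Resp_comp hy)) h
  have hone : ∀ p, p ∈ Theta (compD D B r) (compB D B r) → ∀ i k, k ∈ (Csub D B r)ᶜ →
      (1 - p.1) i k = (1 : Matrix ↥(Vset D B r) ↥(Vset D B r) ℝ) i k := by
    intro p hp i k hk
    simp [col_comp hp i k (Finset.mem_compl.1 hk)]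
  have hL : ∀ i ∈ (Csub D B r)ᶜ, ∀ c ∈ (Csub D B r)ᶜ,
      L i c = (1 : Matrix ↥(Vset D B r) ↥(Vset D B r) ℝ) i c := by
    intro i hi c hc
    rw [← hone y hy i c hc, ← h1 i c hc, Finset.sum_eq_single i]
    · rw [hone z hz i i hi]; simp
    · intro k hk hki
      rw [hone z hz i k hk, Matrix.one_apply_ne hki.symm, zero_mul]
    · intro h; exact absurd hi h
  have ha' := Finset.mem_compl.2 ha
  have hb' := Finset.mem_compl.2 hb
  rw [h2 a ha' b hb', Finset.sum_eq_single a, Finset.sum_eq_single b]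
  · rw [hL a ha' a ha', hL b hb' b hb']; simp
  · intro l hl hlb
    rw [hL l hl b hb', Matrix.one_apply_ne hlb, mul_zero]
  · intro h; exact absurd hb' h
  · intro k hk hka
    refine Finset.sum_eq_zero fun l _ => ?_
    rw [hL k hk a ha', Matrix.one_apply_ne hka]; simp
  · intro h; exact absurd ha' h

lemma phi_proj_of {D B : Finset (Fin n × Fin n)} (hac : Acyclic D) {R : Finset (Fin n)}
    {rep : Fin n → R} (hC : ∀ (r : R) v, v ∈ Cset B r ↔ rep v = r)
    (hB : ∀ a b, (a, b) ∈ B → rep a = rep b) {p q}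
    (hp : p ∈ Theta (↑D : Set (Fin n × Fin n)) ↑B)
    (hq : q ∈ Theta (↑D : Set (Fin n × Fin n)) ↑B) (h : phi q = phi p)
    (r : R) {w : CP D B r} (hw : w ∈ Theta (compD D B r) (compB D B r)) :
    phi (proj D B r w.2 q) = phi (proj D B r w.2 p) := by
  have hp' := proj_mem hw hp
  have hq' := proj_mem hw hq
  have b1 := BR_proj w.2 (BR_of_phi (UTri_G hac hp) (UTri_G hac hq) hp.2.1 (Cset B r)
    (Resp_G hC hB hp r) (Resp_G hC hB hq r) h)
  refine phi_of_BR (UTri_comp hac hp') (UTri_comp hac hq')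
    (fun a => decide (a ∈ Csub D B r)) ?_ ?_ ?_
  · intro a b hab
    simp only [ne_eq, decide_eq_decide] at hab
    exact Resp_comp hp' a b (by tauto)
  · intro a b hab
    simp only [ne_eq, decide_eq_decide] at hab
    exact Resp_comp hq' a b (by tauto)
  · intro t
    cases t with
    | true =>
      convert b1 using 1
      ext a; simp
    | false =>
      have hone : ∀ p, p ∈ Theta (compD D B r) (compB D B r) → ∀ i k, k ∉ Csub D B r →
          (1 - p.1) i k = (1 : Matrix ↥(Vset D B r) ↥(Vset D B r) ℝ) i k := by
        intro p hp i k hk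
        simp [col_comp hp i k hk]
      refine ⟨1, ?_, ?_⟩
      · intro i c hc
        simp only [decide_eq_false_iff_not, Finset.mem_filter, Finset.mem_univ, true_and] at hc
        rw [Finset.sum_eq_single c]
        · rw [hone _ hp' i c hc, hone _ hq' i c hc]; simp
        · intro k _ hk; rw [Matrix.one_apply_ne hk, mul_zero]
        · intro h; simp [hc] at h
      · intro c hc d hd
        simp only [decide_eq_false_iff_not, Finset.mem_filter, Finset.mem_univ, true_and] at hc hd
        rw [Finset.sum_eq_single c, Finset.sum_eq_single d]
        · rw [mem_Csub] at hc
          simp [proj, hc]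
        · intro k _ hk; rw [Matrix.one_apply_ne hk, mul_zero]
        · intro h; simp [hd] at h
        · intro k _ hk
          refine Finset.sum_eq_zero fun l _ => ?_
          rw [Matrix.one_apply_ne hk]; simp
        · intro h; simp [hc] at h

lemma phi_of_proj {D B : Finset (Fin n × Fin n)} (hac : Acyclic D) {R : Finset (Fin n)}
    {rep : Fin n → R} (hC : ∀ (r : R) v, v ∈ Cset B r ↔ rep v = r)
    (hB : ∀ a b, (a, b) ∈ B → rep a = rep b) {p q}
    (hp : p ∈ Theta (↑D : Set (Fin n × Fin n)) ↑B)
    (hq : q ∈ Theta (↑D : Set (Fin n × Fin n)) ↑B)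
    {w : ∀ r : R, CP D B r} (hw : ∀ r : R, w r ∈ Theta (compD D B r) (compB D B r))
    (h : ∀ r : R, phi (proj D B r (w r).2 q) = phi (proj D B r (w r).2 p)) :
    phi q = phi p := by
  refine phi_of_BR (UTri_G hac hp) (UTri_G hac hq) rep (block_G hB hp) (block_G hB hq) ?_
  intro r
  have hp' := proj_mem (hw r) hp
  have hq' := proj_mem (hw r) hq
  have b1 := BR_of_proj (w r).2 hp hq (BR_of_phi (UTri_comp hac hp') (UTri_comp hac hq') hp'.2.1
    (Csub D B r) (Resp_comp hp') (Resp_comp hq') (h r))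
  convert b1 using 1
  ext a; simp [hC]

/-- pulling back a polynomial along `proj` -/
noncomputable def pull (D B : Finset (Fin n × Fin n)) (r : Fin n)
    (W : Matrix ↥(Vset D B r) ↥(Vset D B r) ℝ)
    (f : MvPolynomial ((↥(Vset D B r) × ↥(Vset D B r)) ⊕ (↥(Vset D B r) × ↥(Vset D B r))) ℝ) :
    MvPolynomial ((Fin n × Fin n) ⊕ (Fin n × Fin n)) ℝ :=
  MvPolynomial.bind₁ (Sum.elim
    (fun e => if (e.2 : Fin n) ∈ Cset B r then MvPolynomial.X (Sum.inl ((e.1 : Fin n), (e.2 : Fin n)))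
      else 0)
    (fun e => if (e.1 : Fin n) ∈ Cset B r ∧ (e.2 : Fin n) ∈ Cset B r then
      MvPolynomial.X (Sum.inr ((e.1 : Fin n), (e.2 : Fin n))) else MvPolynomial.C (W e.1 e.2))) f

lemma polyEval_pull (D B : Finset (Fin n × Fin n)) (r : Fin n)
    (W : Matrix ↥(Vset D B r) ↥(Vset D B r) ℝ) (f) (q) :
    polyEval (pull D B r W f) q = polyEval f (proj D B r W q) := by
  unfold polyEval pull
  rw [← MvPolynomial.coe_aeval_eq_eval, ← MvPolynomial.coe_aeval_eq_eval]
  simp only [RingHom.coe_coe]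
  rw [MvPolynomial.aeval_bind₁]
  congr 2
  funext e
  rcases e with e | e
  · simp only [Sum.elim_inl, proj, Matrix.of_apply]
    split_ifs <;> simp
  · simp only [Sum.elim_inr, proj, Matrix.of_apply]
    split_ifs <;> simp

end Components

theorem stmt14 (n : ℕ) (D B : Finset (Fin n × Fin n))
    (hG : IsMixedGraph D B) (hacyc : Acyclic D)
    (R : Finset (Fin n))
    (hrep : ∀ v : Fin n, ∃! r : Fin n, r ∈ R ∧ bidirConn B r v)
    (h : Fin n → ℕ)
    (hcomp : ∀ r ∈ R, GenHToOne (compD D B r) (compB D B r) (h r)) :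
    GenHToOne (↑D : Set (Fin n × Fin n)) ↑B (∏ r ∈ R, h r) := by
  choose rep0 hrep1 hrep2 using hrep
  let rep : Fin n → R := fun v => ⟨rep0 v, (hrep1 v).1⟩
  have hC : ∀ (r : R) v, v ∈ Cset B r ↔ rep v = r := by
    intro r v
    simp only [Cset, Finset.mem_filter, Finset.mem_univ, true_and, rep, Subtype.ext_iff]
    constructor
    · intro hv; exact (hrep2 v r ⟨r.2, hv⟩).symm
    · intro hv; rw [← hv]; exact (hrep1 v).2
  have hB : ∀ a b, (a, b) ∈ B → rep a = rep b := by
    intro a b hab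
    refine Subtype.ext (hrep2 b (rep0 a) ⟨(hrep1 a).1, (hrep1 a).2.tail hab⟩)
  have hcomp' : ∀ r : R, GenHToOne (compD D B r) (compB D B r) (h r) := fun r => hcomp r r.2
  choose A hA hfib using hcomp'
  choose f hf hAf using hA
  choose w hw hfw using hf
  refine ⟨_, ⟨∏ r : R, pull D B r (w r).2 (f r), ⟨asm D B rep w, asm_mem hC hw, ?_⟩, rfl⟩, ?_⟩
  · have : polyEval (∏ r : R, pull D B r (w r).2 (f r)) (asm D B rep w) =
        ∏ r : R, polyEval (pull D B r (w r).2 (f r)) (asm D B rep w) := by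
      unfold polyEval; rw [map_prod]
    rw [this, Finset.prod_ne_zero_iff]
    intro r _
    rw [polyEval_pull, proj_asm hC r (hw r) _ (fun _ _ _ => rfl)]
    exact hfw r
  · rintro p ⟨hp, hpA⟩
    have hne : ∀ r : R, polyEval (f r) (proj D B r (w r).2 p) ≠ 0 := by
      intro r h0
      refine hpA ⟨hp, ?_⟩
      rw [← polyEval_pull] at h0
      unfold polyEval at h0 ⊢
      rw [map_prod]
      exact Finset.prod_eq_zero (Finset.mem_univ r) h0
    have hfin : ∀ r : R, (fiber (compD D B r) (compB D B r) (proj D B r (w r).2 p)).Finite ∧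
        (fiber (compD D B r) (compB D B r) (proj D B r (w r).2 p)).ncard = h r := by
      intro r
      refine hfib r _ ⟨proj_mem (hw r) hp, ?_⟩
      rw [hAf r]
      exact fun hh => hne r hh.2
    let F : fiber (↑D : Set (Fin n × Fin n)) ↑B p →
        ∀ r : R, fiber (compD D B r) (compB D B r) (proj D B r (w r).2 p) := fun q r =>
      ⟨proj D B r (w r).2 q.1, proj_mem (hw r) q.2.1,
        phi_proj_of hacyc hC hB hp q.2.1 q.2.2 r (hw r)⟩
    have hF : Function.Bijective F := by
      constructor
      · intro q q' hqq
        refine Subtype.ext (proj_inj hC hB (fun r => (w r).2) q.2.1 q'.2.1 fun r => ?_)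
        exact congrArg Subtype.val (congrFun hqq r)
      · intro y
        have hy : ∀ r : R, (y r).1 ∈ Theta (compD D B r) (compB D B r) := fun r => (y r).2.1
        have hm := asm_mem (rep := rep) hC hy
        have hpr : ∀ r : R, proj D B r (w r).2 (asm D B rep fun r => (y r).1) = (y r).1 := by
          intro r
          refine proj_asm (y := fun r => (y r).1) hC r (hy r) _ ?_
          intro a b hab
          rw [outside_eq hacyc (hy r) (proj_mem (hw r) hp) (y r).2.2 a b hab]
          simp only [proj, Matrix.of_apply, if_neg hab]
        refine ⟨⟨asm D B rep fun r => (y r).1, hm, ?_⟩, ?_⟩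
        · refine phi_of_proj hacyc hC hB hp hm hw fun r => ?_
          rw [hpr r]
          exact (y r).2.2
        · funext r
          exact Subtype.ext (hpr r)
    have hfi : ∀ r : R, Finite (fiber (compD D B r) (compB D B r) (proj D B r (w r).2 p)) :=
      fun r => (hfin r).1.to_subtype
    constructor
    · exact Set.finite_coe_iff.1 (Finite.of_injective F hF.1)
    · rw [← Nat.card_coe_set_eq, Nat.card_congr (Equiv.ofBijective F hF), Nat.card_pi]
      rw [← Finset.prod_coe_sort R h]
      refine Finset.prod_congr rfl fun r _ => ?_
      rw [Nat.card_coe_set_eq, (hfin r).2]
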